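/- Let (A, φ) be a non-commutative probability space with free cumulants κ_n, and let A_1, A_2 be unital subalgebras generated by subsets G_1, G_2 respectively. If for every k ≥ 1, every tuple of indices i_1,...,i_k ∈ {1,2} not all equal, and every choice a_t ∈ G_{i_t}, one has κ_k(a_1,...,a_k) = 0, then A_1 and A_2 are freely independent in (A, φ). -/

import Mathlib

open scoped Classical

/-- Non-crossing condition on the set of classes of a partition, for a linear order. -/
def IsNC {α : Type*} [LinearOrder α] (parts : Finset (Finset α)) : Prop :=
  ∀ i j k l : α, i < k → k < j → j < l →
    ∀ B ∈ parts, ∀ C ∈ parts, B ≠ C →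
      i ∈ B → j ∈ B → k ∈ C → l ∈ C → False

/-- The non-crossing partition lattice `NC(n)` of `{1,...,n}`. -/
abbrev NCP (n : ℕ) := {π : Finpartition (Finset.univ : Finset (Fin n)) // IsNC π.parts}

/-- The multiplicative extension `f_π(x₁,...,xₙ) = ∏_{C ∈ π} f_{|C|}(x_c : c ∈ C)`
of a family of functions, the arguments in each factor listed in increasing order. -/
noncomputable def extMul {X : Type*} (f : ∀ k, (Fin k → X) → ℂ) {n : ℕ}
    (π : Finpartition (Finset.univ : Finset (Fin n))) (x : Fin n → X) : ℂ :=
  ∏ C ∈ π.parts, f C.card (fun i => x (C.orderIsoOfFin rfl i).1)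

/-- The family `κ` satisfies the moment–cumulant relations
`φ(a₁ ⋯ aₙ) = Σ_{π ∈ NC(n)} κ_π(a₁,...,aₙ)` for the linear functional `φ`,
i.e. `κ` is the family of free cumulants of `(A, φ)`. -/
def MomentCumulant {A : Type*} [Ring A] [Algebra ℂ A]
    (φ : A →ₗ[ℂ] ℂ) (κ : ∀ k, (Fin k → A) → ℂ) : Prop :=
  ∀ (n : ℕ) (_ : n ≠ 0) (a : Fin n → A),
    φ (List.ofFn a).prod = ∑ π : NCP n, extMul κ π.1 a

section NonCrossing

variable {α β : Type*} [LinearOrder α] [LinearOrder β]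

/-- `Q` is the set of blocks of a non-crossing partition of the finite set `s`. -/
structure IsNCPartition (s : Finset α) (Q : Finset (Finset α)) : Prop where
  empty_notMem : ∅ ∉ Q
  subset : ∀ C ∈ Q, C ⊆ s
  exists_mem : ∀ a ∈ s, ∃ C ∈ Q, a ∈ C
  eq_of_mem : ∀ C ∈ Q, ∀ D ∈ Q, ∀ a, a ∈ C → a ∈ D → C = D
  isNC : IsNC Q

/-- The non-crossing partitions of a finite set, each given by its set of blocks. -/
noncomputable def ncPartitions (s : Finset α) : Finset (Finset (Finset α)) :=
  {Q ∈ s.powerset.powerset | IsNCPartition s Q}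

lemma mem_ncPartitions {s : Finset α} {Q : Finset (Finset α)} :
    Q ∈ ncPartitions s ↔ IsNCPartition s Q := by
  simp only [ncPartitions, Finset.mem_filter, Finset.mem_powerset, and_iff_right_iff_imp]
  exact fun h C hC => Finset.mem_powerset.2 (h.subset C hC)

/-- Each block of `Q` that meets `J` lies inside `J`. -/
def Saturated (J : Finset α) (Q : Finset (Finset α)) : Prop :=
  ∀ C ∈ Q, ∀ a ∈ C, a ∈ J → C ⊆ J

lemma IsNCPartition.map {s : Finset α} {Q : Finset (Finset α)} (h : IsNCPartition s Q)
    (e : α ↪o β) :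
    IsNCPartition (s.map e.toEmbedding)
      (Q.map (Finset.mapEmbedding e.toEmbedding).toEmbedding) := by
  refine ⟨?_, ?_, ?_, ?_, ?_⟩
  · simp only [Finset.mem_map, not_exists, not_and]
    rintro C hC h0
    have : C = ∅ := by simpa using h0
    exact h.empty_notMem (this ▸ hC)
  · simp only [Finset.mem_map]
    rintro _ ⟨C, hC, rfl⟩
    simpa using h.subset C hC
  · simp only [Finset.mem_map]
    rintro _ ⟨a, ha, rfl⟩
    obtain ⟨C, hC, haC⟩ := h.exists_mem a ha
    exact ⟨_, ⟨C, hC, rfl⟩, by simpa using haC⟩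
  · simp only [Finset.mem_map]
    rintro _ ⟨C, hC, rfl⟩ _ ⟨D, hD, rfl⟩ b hb hb'
    simp only [RelEmbedding.coe_toEmbedding, Finset.mapEmbedding_apply, Finset.mem_map] at hb hb'
    obtain ⟨a, ha, rfl⟩ := hb
    obtain ⟨a', ha', hh⟩ := hb'
    obtain rfl := e.injective hh
    rw [h.eq_of_mem C hC D hD a' ha ha']
  · intro i j k l hik hkj hjl B hB C hC hBC hi hj hk hl
    simp only [Finset.mem_map] at hB hC
    obtain ⟨B, hB, rfl⟩ := hB
    obtain ⟨C, hC, rfl⟩ := hC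
    simp only [RelEmbedding.coe_toEmbedding, Finset.mapEmbedding_apply, Finset.mem_map]
      at hi hj hk hl
    obtain ⟨i, hi, rfl⟩ := hi
    obtain ⟨j, hj, rfl⟩ := hj
    obtain ⟨k, hk, rfl⟩ := hk
    obtain ⟨l, hl, rfl⟩ := hl
    refine h.isNC i j k l (e.lt_iff_lt.1 hik) (e.lt_iff_lt.1 hkj) (e.lt_iff_lt.1 hjl) B hB C hC
      (fun hh => hBC (by rw [hh])) hi hj hk hl

lemma IsNCPartition.exists_map {s : Finset α} (e : α ↪o β) {Q : Finset (Finset β)}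
    (h : IsNCPartition (s.map e.toEmbedding) Q) :
    ∃ P, IsNCPartition s P ∧ P.map (Finset.mapEmbedding e.toEmbedding).toEmbedding = Q := by
  have key : ∀ D ∈ Q, ∃ C, C ⊆ s ∧ C.map e.toEmbedding = D := fun D hD => by
    obtain ⟨C, hC, hCD⟩ := Finset.subset_map_iff.1 (h.subset D hD)
    exact ⟨C, hC, hCD.symm⟩
  refine ⟨s.powerset.filter (fun C => C.map e.toEmbedding ∈ Q), ⟨?_, ?_, ?_, ?_, ?_⟩, ?_⟩
  · simpa using h.empty_notMem
  · simp +contextual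
  · intro a ha
    obtain ⟨D, hD, haD⟩ := h.exists_mem (e a) (by simpa using ha)
    obtain ⟨C, hC, rfl⟩ := key D hD
    exact ⟨C, by simp [hC, hD], by simpa using haD⟩
  · intro C hC D hD a haC haD
    simp only [Finset.mem_filter] at hC hD
    exact Finset.map_injective _
      (h.eq_of_mem _ hC.2 _ hD.2 (e a) (by simpa using haC) (by simpa using haD))
  · intro i j k l hik hkj hjl B hB C hC hBC hi hj hk hl
    simp only [Finset.mem_filter] at hB hC
    exact h.isNC (e i) (e j) (e k) (e l) (e.lt_iff_lt.2 hik) (e.lt_iff_lt.2 hkj)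
      (e.lt_iff_lt.2 hjl) _ hB.2 _ hC.2 (fun hh => hBC (Finset.map_injective _ hh))
      (by simpa using hi) (by simpa using hj) (by simpa using hk) (by simpa using hl)
  · ext D
    simp only [Finset.mem_map, Finset.mem_filter, Finset.mem_powerset]
    constructor
    · rintro ⟨C, ⟨-, hC⟩, rfl⟩
      exact hC
    · intro hD
      obtain ⟨C, hC, rfl⟩ := key D hD
      exact ⟨C, ⟨hC, hD⟩, rfl⟩

lemma Finpartition.isNCPartition_parts {s : Finset α} (π : Finpartition s) (h : IsNC π.parts) :
    IsNCPartition s π.parts where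
  empty_notMem := π.bot_notMem
  subset _ hC := π.le hC
  exists_mem _ ha := π.exists_mem ha
  eq_of_mem _ hC _ hD _ haC haD := π.eq_of_mem_parts hC hD haC haD
  isNC := h

lemma IsNCPartition.exists_finpartition {s : Finset α} {Q : Finset (Finset α)}
    (h : IsNCPartition s Q) : ∃ π : Finpartition s, π.parts = Q :=
  ⟨Finpartition.ofExistsUnique Q h.subset (fun a ha => by
    obtain ⟨C, hC, haC⟩ := h.exists_mem a ha
    exact ⟨C, ⟨hC, haC⟩, fun D hD => h.eq_of_mem D hD.1 C hC a hD.2 haC⟩) h.empty_notMem, rfl⟩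

lemma sum_NCP {M : Type*} [AddCommMonoid M] (n : ℕ) (f : Finset (Finset (Fin n)) → M) :
    ∑ π : NCP n, f π.1.parts = ∑ Q ∈ ncPartitions (Finset.univ : Finset (Fin n)), f Q := by
  refine Finset.sum_bij (fun π _ => π.1.parts) ?_ ?_ ?_ ?_
  · exact fun π _ => mem_ncPartitions.2 (π.1.isNCPartition_parts π.2)
  · exact fun π _ π' _ h => Subtype.ext (Finpartition.ext h)
  · intro Q hQ
    have hQ := mem_ncPartitions.1 hQ
    obtain ⟨π, rfl⟩ := hQ.exists_finpartition
    exact ⟨⟨π, hQ.isNC⟩, Finset.mem_univ _, rfl⟩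
  · exact fun _ _ => rfl

lemma sum_ncPartitions_map {M : Type*} [AddCommMonoid M] (s : Finset α) (e : α ↪o β)
    (f : Finset (Finset β) → M) :
    ∑ Q ∈ ncPartitions s, f (Q.map (Finset.mapEmbedding e.toEmbedding).toEmbedding) =
      ∑ Q ∈ ncPartitions (s.map e.toEmbedding), f Q := by
  refine Finset.sum_bij (fun Q _ => Q.map (Finset.mapEmbedding e.toEmbedding).toEmbedding)
    ?_ ?_ ?_ ?_
  · exact fun Q hQ => mem_ncPartitions.2 ((mem_ncPartitions.1 hQ).map e)
  · exact fun _ _ _ _ h => Finset.map_injective _ h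
  · intro Q hQ
    obtain ⟨P, hP, rfl⟩ := (mem_ncPartitions.1 hQ).exists_map e
    exact ⟨P, mem_ncPartitions.2 hP, rfl⟩
  · exact fun _ _ => rfl

/-- Gluing non-crossing partitions of an interval `I` of `s` and of its complement. -/
lemma IsNCPartition.union {s I : Finset α} (hI : I ⊆ s)
    (hconv : ∀ a ∈ I, ∀ b ∈ I, ∀ c ∈ s, a < c → c < b → c ∈ I) {P Q : Finset (Finset α)}
    (hP : IsNCPartition I P) (hQ : IsNCPartition (s \ I) Q) : IsNCPartition s (P ∪ Q) := by
  have hdisj : ∀ C ∈ P, ∀ D ∈ Q, ∀ a, a ∈ C → a ∈ D → False := fun C hC D hD a haC haD =>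
    (Finset.mem_sdiff.1 (hQ.subset D hD haD)).2 (hP.subset C hC haC)
  refine ⟨?_, ?_, ?_, ?_, ?_⟩
  · simp [hP.empty_notMem, hQ.empty_notMem]
  · intro C hC
    rcases Finset.mem_union.1 hC with hC | hC
    · exact (hP.subset C hC).trans hI
    · exact (hQ.subset C hC).trans Finset.sdiff_subset
  · intro a ha
    by_cases haI : a ∈ I
    · obtain ⟨C, hC, haC⟩ := hP.exists_mem a haI
      exact ⟨C, Finset.mem_union_left _ hC, haC⟩
    · obtain ⟨C, hC, haC⟩ := hQ.exists_mem a (Finset.mem_sdiff.2 ⟨ha, haI⟩)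
      exact ⟨C, Finset.mem_union_right _ hC, haC⟩
  · intro C hC D hD a haC haD
    rcases Finset.mem_union.1 hC with hC | hC <;> rcases Finset.mem_union.1 hD with hD | hD
    · exact hP.eq_of_mem C hC D hD a haC haD
    · exact (hdisj C hC D hD a haC haD).elim
    · exact (hdisj D hD C hC a haD haC).elim
    · exact hQ.eq_of_mem C hC D hD a haC haD
  · intro i j k l hik hkj hjl C hC D hD hne hi hj hk hl
    rcases Finset.mem_union.1 hC with hC | hC <;> rcases Finset.mem_union.1 hD with hD | hD
    · exact hP.isNC i j k l hik hkj hjl C hC D hD hne hi hj hk hl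
    · have := Finset.mem_sdiff.1 (hQ.subset D hD hk)
      exact this.2 (hconv i (hP.subset C hC hi) j (hP.subset C hC hj) k this.1 hik hkj)
    · have := Finset.mem_sdiff.1 (hQ.subset C hC hj)
      exact this.2 (hconv k (hP.subset D hD hk) l (hP.subset D hD hl) j this.1 hkj hjl)
    · exact hQ.isNC i j k l hik hkj hjl C hC D hD hne hi hj hk hl

lemma IsNCPartition.filter_subset {s I : Finset α} (hI : I ⊆ s) {Q : Finset (Finset α)}
    (hQ : IsNCPartition s Q) (hsat : Saturated I Q) :
    IsNCPartition I {C ∈ Q | C ⊆ I} where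
  empty_notMem h := hQ.empty_notMem (Finset.mem_filter.1 h).1
  subset C hC := (Finset.mem_filter.1 hC).2
  exists_mem a ha := by
    obtain ⟨C, hC, haC⟩ := hQ.exists_mem a (hI ha)
    exact ⟨C, Finset.mem_filter.2 ⟨hC, hsat C hC a haC ha⟩, haC⟩
  eq_of_mem C hC D hD :=
    hQ.eq_of_mem C (Finset.mem_filter.1 hC).1 D (Finset.mem_filter.1 hD).1
  isNC i j k l hik hkj hjl B hB C hC :=
    hQ.isNC i j k l hik hkj hjl B (Finset.mem_filter.1 hB).1 C (Finset.mem_filter.1 hC).1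

lemma IsNCPartition.filter_not_subset {s I : Finset α} {Q : Finset (Finset α)}
    (hQ : IsNCPartition s Q) (hsat : Saturated I Q) :
    IsNCPartition (s \ I) {C ∈ Q | ¬ C ⊆ I} where
  empty_notMem h := hQ.empty_notMem (Finset.mem_filter.1 h).1
  subset C hC a ha := by
    have hC := Finset.mem_filter.1 hC
    exact Finset.mem_sdiff.2 ⟨hQ.subset C hC.1 ha, fun h => hC.2 (hsat C hC.1 a ha h)⟩
  exists_mem a ha := by
    have ha := Finset.mem_sdiff.1 ha
    obtain ⟨C, hC, haC⟩ := hQ.exists_mem a ha.1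
    exact ⟨C, Finset.mem_filter.2 ⟨hC, fun h => ha.2 (h haC)⟩, haC⟩
  eq_of_mem C hC D hD :=
    hQ.eq_of_mem C (Finset.mem_filter.1 hC).1 D (Finset.mem_filter.1 hD).1
  isNC i j k l hik hkj hjl B hB C hC :=
    hQ.isNC i j k l hik hkj hjl B (Finset.mem_filter.1 hB).1 C (Finset.mem_filter.1 hC).1

lemma IsNCPartition.not_subset_of_sdiff {s I : Finset α} {Q : Finset (Finset α)}
    (hQ : IsNCPartition (s \ I) Q) {C : Finset α} (hC : C ∈ Q) : ¬ C ⊆ I := fun h => by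
  obtain ⟨a, ha⟩ := Finset.nonempty_iff_ne_empty.2 (fun h0 => hQ.empty_notMem (h0 ▸ hC))
  exact (Finset.mem_sdiff.1 (hQ.subset C hC ha)).2 (h ha)

/-- A multiplicative sum over the non-crossing partitions of `s` for which the interval `I` is a
union of blocks factors along `I` and `s \ I`. -/
lemma sum_saturated {R : Type*} [CommSemiring R] {s I : Finset α} (hI : I ⊆ s)
    (hconv : ∀ a ∈ I, ∀ b ∈ I, ∀ c ∈ s, a < c → c < b → c ∈ I) (f : Finset α → R)
    (p : Finset (Finset α) → Prop) [DecidablePred p]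
    (hp : ∀ P Q, IsNCPartition I P → IsNCPartition (s \ I) Q → (p (P ∪ Q) ↔ p Q)) :
    ∑ Q ∈ ncPartitions s with p Q ∧ Saturated I Q, ∏ C ∈ Q, f C =
      (∑ Q ∈ ncPartitions I, ∏ C ∈ Q, f C) *
        ∑ Q ∈ ncPartitions (s \ I) with p Q, ∏ C ∈ Q, f C := by
  rw [Finset.sum_mul_sum, ← Finset.sum_product']
  symm
  refine Finset.sum_bij' (fun x _ => x.1 ∪ x.2)
    (fun Q _ => ({C ∈ Q | C ⊆ I}, {C ∈ Q | ¬ C ⊆ I})) ?_ ?_ ?_ ?_ ?_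
  · rintro ⟨P, Q⟩ h
    simp only [Finset.mem_product, Finset.mem_filter, mem_ncPartitions] at h ⊢
    obtain ⟨hP, hQ, hpQ⟩ := h
    refine ⟨hP.union hI hconv hQ, (hp P Q hP hQ).2 hpQ, fun C hC a haC haI => ?_⟩
    rcases Finset.mem_union.1 hC with hC | hC
    · exact hP.subset C hC
    · exact ((Finset.mem_sdiff.1 (hQ.subset C hC haC)).2 haI).elim
  · intro Q h
    simp only [Finset.mem_product, Finset.mem_filter, mem_ncPartitions] at h ⊢
    obtain ⟨hQ, hpQ, hsat⟩ := h
    refine ⟨hQ.filter_subset hI hsat, hQ.filter_not_subset hsat, ?_⟩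
    rw [← hp _ _ (hQ.filter_subset hI hsat) (hQ.filter_not_subset hsat),
      Finset.filter_union_filter_not_eq]
    exact hpQ
  · rintro ⟨P, Q⟩ h
    simp only [Finset.mem_product, Finset.mem_filter, mem_ncPartitions] at h
    obtain ⟨hP, hQ, -⟩ := h
    have h1 := hP.subset
    have h2 : ∀ C ∈ Q, ¬ C ⊆ I := fun C hC => hQ.not_subset_of_sdiff hC
    refine Prod.ext ?_ ?_ <;> ext C <;> simp only [Finset.mem_filter, Finset.mem_union] <;> grind
  · intro Q _
    exact Finset.filter_union_filter_not_eq _ _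
  · rintro ⟨P, Q⟩ h
    simp only [Finset.mem_product, Finset.mem_filter, mem_ncPartitions] at h
    obtain ⟨hP, hQ, -⟩ := h
    exact (Finset.prod_union (Finset.disjoint_left.2 fun C hC hC' =>
      hQ.not_subset_of_sdiff hC' (hP.subset C hC))).symm

/-- If adjacent fibres of a monotone map `τ` are never joined by a block, then some fibre is a
union of blocks. -/
lemma IsNCPartition.exists_saturated [Fintype α] {k : ℕ} (hk : k ≠ 0) {τ : α → Fin k}
    (hτ : Monotone τ) {Q : Finset (Finset α)} (hQ : IsNCPartition Finset.univ Q)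
    (hadj : ∀ C ∈ Q, ∀ a ∈ C, ∀ b ∈ C, (τ a).val + 1 ≠ τ b) :
    ∃ t, Saturated {p | τ p = t} Q := by
  by_contra! hcon
  have hns : ∀ t, ∃ C ∈ Q, ∃ a ∈ C, ∃ b ∈ C, τ a = t ∧ τ b ≠ t := fun t => by
    have := hcon t
    simp only [Saturated, Finset.subset_iff, Finset.mem_filter, Finset.mem_univ, true_and] at this
    push Not at this
    obtain ⟨C, hC, a, ha, hat, b, hb, hbt⟩ := this
    exact ⟨C, hC, a, ha, b, hb, hat, hbt⟩
  have main : ∀ d : ℕ, ∀ C ∈ Q, ∀ a ∈ C, ∀ b ∈ C, τ a < τ b → (τ b).val - τ a ≤ d → False := by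
    intro d
    induction d with
    | zero =>
      intro C hC a ha b hb hab hd
      have : (τ a).val < τ b := hab
      omega
    | succ d ih =>
      intro C hC a ha b hb hab hd
      have hab' : (τ a).val < τ b := hab
      have hne := hadj C hC a ha b hb
      obtain ⟨D, hD, c, hc, c', hc', hct, hct'⟩ := hns ⟨(τ a).val + 1, by omega⟩
      have hcv : (τ c).val = (τ a).val + 1 := by rw [hct]
      have hcv' : (τ c').val ≠ (τ a).val + 1 := fun h => hct' (Fin.ext h)
      have hac : a < c := hτ.reflect_lt (Fin.lt_def.2 (by omega))
      have hcb : c < b := hτ.reflect_lt (Fin.lt_def.2 (by omega))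
      by_cases hCD : C = D
      · subst hCD
        exact hadj C hC a ha c hc hcv.symm
      have hac' : a < c' := by
        by_contra! h
        rcases h.eq_or_lt with rfl | h
        · exact hCD (hQ.eq_of_mem C hC D hD c' ha hc')
        · exact hQ.isNC c' c a b h hac hcb D hD C hC (Ne.symm hCD) hc' hc ha hb
      have hcb' : c' < b := by
        by_contra! h
        rcases h.eq_or_lt with rfl | h
        · exact hCD (hQ.eq_of_mem C hC D hD b hb hc')
        · exact hQ.isNC a b c c' hac hcb h C hC D hD hCD ha hb hc hc'
      have h1 : (τ a).val ≤ τ c' := hτ hac'.le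
      have h2 : (τ c').val ≤ τ b := hτ hcb'.le
      have h3 : (τ c').val ≠ τ a := fun h => hadj D hD c' hc' c hc (by omega)
      exact ih D hD c hc c' hc' (Fin.lt_def.2 (by omega)) (by omega)
  obtain ⟨C, hC, a, ha, b, hb, hat, hbt⟩ := hns ⟨0, Nat.pos_of_ne_zero hk⟩
  have h0 : (τ a).val = 0 := by rw [hat]
  have h1 : (τ b).val ≠ 0 := fun h => hbt (Fin.ext h)
  exact main _ C hC a ha b hb (Fin.lt_def.2 (by omega)) le_rfl

end NonCrossing

section Moments

variable {A : Type*} {α β : Type*} [LinearOrder α] [LinearOrder β]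

/-- The product of the letters `x p`, `p ∈ s`, in increasing order. -/
noncomputable def orderedProd [Monoid A] (x : α → A) (s : Finset α) : A :=
  (s.sort.map x).prod

/-- The value of `κ` on the letters `x p`, `p ∈ C`, in increasing order. -/
noncomputable def blockValue (κ : ∀ k, (Fin k → A) → ℂ) (x : α → A) (C : Finset α) : ℂ :=
  κ C.card (fun i => x (C.orderIsoOfFin rfl i).1)

lemma blockValue_eq (κ : ∀ k, (Fin k → A) → ℂ) (x : α → A) {C : Finset α} {m : ℕ}
    (h : C.card = m) : blockValue κ x C = κ m (fun i => x (C.orderIsoOfFin h i).1) := by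
  subst h
  rfl

lemma blockValue_map (κ : ∀ k, (Fin k → A) → ℂ) (x : β → A) (e : α ↪o β) (C : Finset α) :
    blockValue κ x (C.map e.toEmbedding) = blockValue κ (x ∘ e) C := by
  rw [blockValue_eq κ x (Finset.card_map e.toEmbedding), blockValue]
  congr 1
  funext i
  simp only [Function.comp_apply, Finset.coe_orderIsoOfFin_apply]
  congr 1
  have := Finset.orderEmbOfFin_unique' (Finset.card_map e.toEmbedding (s := C))
    (f := (C.orderEmbOfFin rfl).trans e) (fun i => by simp)
  rw [← this]
  rfl

lemma orderedProd_map [Monoid A] (x : β → A) (e : α ↪o β) (s : Finset α) :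
    orderedProd x (s.map e.toEmbedding) = orderedProd (x ∘ e) s := by
  have : (s.map e.toEmbedding).sort = s.sort.map e := by
    refine List.Perm.eq_of_sortedLE (Finset.sortedLT_sort _).sortedLE ?_ ?_
    · exact (e.strictMono.sortedLT_listMap.2 (Finset.sortedLT_sort _)).sortedLE
    · rw [← Multiset.coe_eq_coe, Finset.sort_eq, ← Multiset.map_coe, Finset.sort_eq]
      rfl
  rw [orderedProd, orderedProd, this, List.map_map]

lemma orderedProd_univ [Monoid A] {n : ℕ} (x : Fin n → A) :
    orderedProd x Finset.univ = (List.ofFn x).prod := by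
  rw [orderedProd, Fin.sort_univ, List.ofFn_eq_map]

@[simp]
lemma orderedProd_empty [Monoid A] (x : α → A) : orderedProd x ∅ = 1 := by
  simp [orderedProd]

lemma orderedProd_union [Monoid A] (x : α → A) {s t : Finset α}
    (h : ∀ a ∈ s, ∀ b ∈ t, a < b) :
    orderedProd x (s ∪ t) = orderedProd x s * orderedProd x t := by
  have : (s ∪ t).sort = s.sort ++ t.sort := by
    refine List.Perm.eq_of_sortedLE (Finset.sortedLT_sort _).sortedLE ?_ ?_
    · refine List.Pairwise.sortedLE (List.pairwise_append.2
        ⟨Finset.pairwise_sort _ _, Finset.pairwise_sort _ _, fun a ha b hb => ?_⟩)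
      exact (h a (by simpa using ha) b (by simpa using hb)).le
    · have hd : Disjoint s t := Finset.disjoint_left.2 fun a ha hb => (h a ha a hb).false
      rw [← Multiset.coe_eq_coe, Finset.sort_eq, ← Multiset.coe_add, Finset.sort_eq,
        Finset.sort_eq, ← Finset.disjUnion_eq_union s t hd]
      rfl
  rw [orderedProd, orderedProd, orderedProd, this, List.map_append, List.prod_append]

lemma ncPartitions_empty : ncPartitions (∅ : Finset α) = {∅} := by
  ext Q
  rw [mem_ncPartitions, Finset.mem_singleton]
  constructor
  · intro h
    refine Finset.eq_empty_of_forall_notMem fun C hC => h.empty_notMem ?_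
    rwa [← Finset.subset_empty.1 (h.subset C hC)]
  · rintro rfl
    exact ⟨by simp, by simp, by simp, by simp, by simp [IsNC]⟩

/-- The moment–cumulant relation for the letters indexed by a finite subset of a linear order. -/
lemma MomentCumulant.orderedProd_eq [Ring A] [Algebra ℂ A] {φ : A →ₗ[ℂ] ℂ}
    {κ : ∀ k, (Fin k → A) → ℂ} (hκ : MomentCumulant φ κ) (hunit : φ 1 = 1) (x : α → A)
    (s : Finset α) :
    φ (orderedProd x s) = ∑ Q ∈ ncPartitions s, ∏ C ∈ Q, blockValue κ x C := by
  rcases s.eq_empty_or_nonempty with rfl | hs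
  · simp [ncPartitions_empty, hunit]
  obtain ⟨e, he⟩ : ∃ e : Fin s.card ↪o α, Finset.univ.map e.toEmbedding = s :=
    ⟨s.orderEmbOfFin rfl, Finset.map_orderEmbOfFin_univ s rfl⟩
  rw [← he, orderedProd_map, orderedProd_univ, hκ _ (by simpa using hs.ne_empty),
    ← sum_ncPartitions_map]
  simp only [Finset.prod_map, RelEmbedding.coe_toEmbedding, Finset.mapEmbedding_apply,
    blockValue_map]
  exact sum_NCP s.card (fun Q => ∏ C ∈ Q, blockValue κ (x ∘ e) C)

/-- Inclusion–exclusion: centering the product of the letters in each of the fibres `t ∈ l` of a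
monotone map discards the non-crossing partitions for which one of these fibres is a union of
blocks. -/
lemma MomentCumulant.centered_prod_eq [Ring A] [Algebra ℂ A] {φ : A →ₗ[ℂ] ℂ}
    {κ : ∀ k, (Fin k → A) → ℂ} (hκ : MomentCumulant φ κ) (hunit : φ 1 = 1) (x : α → A)
    [Fintype α] {ι : Type*} [LinearOrder ι] {τ : α → ι} (hτ : Monotone τ) (l : List ι)
    (hl : l.Pairwise (· < ·)) (U : Finset α) (hU : ∀ p ∈ U, ∀ t ∈ l, τ p < t) :
    φ (orderedProd x U * (l.map fun t => orderedProd x {p | τ p = t} -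
        algebraMap ℂ A (φ (orderedProd x {p | τ p = t}))).prod) =
      ∑ Q ∈ ncPartitions (U ∪ ({p | τ p ∈ l} : Finset α)) with
        ∀ t ∈ l, ¬ Saturated {p | τ p = t} Q, ∏ C ∈ Q, blockValue κ x C := by
  induction l generalizing U with
  | nil => simp [hκ.orderedProd_eq hunit]
  | cons t l ih =>
    obtain ⟨htl, hl⟩ := List.pairwise_cons.1 hl
    set I : Finset α := {p | τ p = t} with hI
    have hUI : ∀ a ∈ U, ∀ b ∈ I, a < b := fun a ha b hb => by
      have hb : τ b = t := by simpa [hI] using hb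
      exact hτ.reflect_lt (hb ▸ hU a ha t (by simp))
    have h1 := ih hl (U ∪ I) (fun p hp t' ht' => by
      rcases Finset.mem_union.1 hp with hp | hp
      · exact hU p hp t' (by simp [ht'])
      · have hp : τ p = t := by simpa [hI] using hp
        exact hp ▸ htl t' ht')
    have h2 := ih hl U (fun p hp t' ht' => hU p hp t' (by simp [ht']))
    have hs1 : U ∪ I ∪ ({p | τ p ∈ l} : Finset α) = U ∪ ({p | τ p ∈ t :: l} : Finset α) := by
      ext p
      simp [hI]
    have hs2 : (U ∪ ({p | τ p ∈ t :: l} : Finset α)) \ I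
        = U ∪ ({p | τ p ∈ l} : Finset α) := by
      ext p
      have h3 : p ∈ U → τ p ≠ t := fun hp => (hU p hp t (by simp)).ne
      have h4 : τ p ∈ l → τ p ≠ t := fun hp => (htl _ hp).ne'
      simp only [hI, Finset.mem_sdiff, Finset.mem_union, Finset.mem_filter, Finset.mem_univ,
        true_and, List.mem_cons]
      tauto
    have h3 := sum_saturated (s := U ∪ ({p | τ p ∈ t :: l} : Finset α)) (I := I)
      (by rw [← hs1]; exact Finset.subset_union_right.trans Finset.subset_union_left)
      (fun a ha b hb c _ hac hcb => by
        simp only [hI, Finset.mem_filter, Finset.mem_univ, true_and] at ha hb ⊢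
        exact le_antisymm (hb ▸ hτ hcb.le) (ha ▸ hτ hac.le))
      (blockValue κ x) (fun Q => ∀ t' ∈ l, ¬ Saturated {p | τ p = t'} Q)
      (fun P Q hP hQ => by
        refine forall₂_congr fun t' ht' => not_congr ⟨fun h C hC => h C (by simp [hC]), ?_⟩
        intro h C hC a haC hat
        rcases Finset.mem_union.1 hC with hC | hC
        · have h5 : τ a = t := by simpa [hI] using hP.subset C hC haC
          have h6 : τ a = t' := by simpa using hat
          exact ((htl t' ht').ne (h5 ▸ h6)).elim
        · exact h C hC a haC hat)
    rw [hs2, ← h2, ← hκ.orderedProd_eq hunit] at h3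
    rw [hs1] at h1
    rw [List.map_cons, List.prod_cons, ← hI, sub_mul, mul_sub, map_sub, ← mul_assoc,
      ← orderedProd_union x hUI, h1, ← Algebra.smul_def, mul_smul_comm, map_smul, smul_eq_mul, ← h3,
      ← Finset.sum_filter_add_sum_filter_not _ (fun Q => Saturated I Q), Finset.filter_filter,
      Finset.filter_filter, add_sub_cancel_left]
    refine Finset.sum_congr (Finset.filter_congr fun Q _ => ?_) fun _ _ => rfl
    simp [and_comm, hI]

/-- Products of centered monomials with adjacent factors in different classes are centered, if the
mixed cumulants vanish. -/
lemma MomentCumulant.centered_words [Ring A] [Algebra ℂ A] {φ : A →ₗ[ℂ] ℂ}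
    {κ : ∀ k, (Fin k → A) → ℂ} (hκ : MomentCumulant φ κ) (hunit : φ 1 = 1)
    {ι : Type*} (G : ι → Set A)
    (hvan : ∀ (k : ℕ), k ≠ 0 → ∀ (idx : Fin k → ι), (¬ ∀ s t, idx s = idx t) →
      ∀ a : Fin k → A, (∀ t, a t ∈ G (idx t)) → κ k a = 0)
    {k : ℕ} (hk : k ≠ 0) (idx : Fin k → ι)
    (hidx : ∀ (t : Fin k) (h : t.val + 1 < k), idx t ≠ idx ⟨t.val + 1, h⟩)
    (w : Fin k → List A) (hw : ∀ t, ∀ y ∈ w t, y ∈ G (idx t)) :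
    φ (List.ofFn fun t => (w t).prod - algebraMap ℂ A (φ (w t).prod)).prod = 0 := by
  let α := Σₗ t : Fin k, Fin (w t).length
  let τ : α → Fin k := fun p => (ofLex p).1
  let x : α → A := fun p => (w (ofLex p).1).get (ofLex p).2
  have hτ : Monotone τ := fun a b hab => by
    rcases Sigma.Lex.le_def.1 hab with h | ⟨h, -⟩
    · exact h.le
    · exact h.le
  have hx : ∀ p, x p ∈ G (idx (τ p)) := fun p => hw _ _ (List.get_mem _ _)
  have hprod : ∀ t, orderedProd x ({p | τ p = t} : Finset α) = (w t).prod := fun t => by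
    let e : Fin (w t).length ↪o α := OrderEmbedding.ofStrictMono (fun i => toLex ⟨t, i⟩)
      (fun i j hij => Sigma.Lex.lt_def.2 (Or.inr ⟨rfl, hij⟩))
    have he : ({p | τ p = t} : Finset α) = Finset.univ.map e.toEmbedding := by
      ext p
      simp only [Finset.mem_filter, Finset.mem_univ, true_and, Finset.mem_map]
      constructor
      · rintro rfl
        exact ⟨(ofLex p).2, rfl⟩
      · rintro ⟨i, rfl⟩
        rfl
    rw [he, orderedProd_map, orderedProd_univ]
    exact congrArg List.prod (List.ofFn_get (w t))
  have hmain := hκ.centered_prod_eq hunit x hτ (List.finRange k) (List.pairwise_lt_finRange k) ∅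
    (by simp)
  simp only [hprod, orderedProd_empty, one_mul, ← List.ofFn_eq_map] at hmain
  rw [hmain]
  refine Finset.sum_eq_zero fun Q hQ => ?_
  simp only [List.mem_finRange, Finset.filter_true, Finset.empty_union, Finset.mem_filter,
    mem_ncPartitions, forall_const] at hQ
  obtain ⟨hQ, hns⟩ := hQ
  by_contra hne
  rw [Finset.prod_eq_zero_iff] at hne
  push Not at hne
  obtain ⟨t, ht⟩ := hQ.exists_saturated hk hτ fun C hC a ha b hb hab => by
    refine hne C hC (hvan C.card (Finset.card_ne_zero_of_mem ha)
      (fun i => idx (τ (C.orderIsoOfFin rfl i).1)) (fun h => ?_) _ (fun i => hx _))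
    have h1 := h ((C.orderIsoOfFin rfl).symm ⟨a, ha⟩) ((C.orderIsoOfFin rfl).symm ⟨b, hb⟩)
    simp only [OrderIso.apply_symm_apply] at h1
    refine hidx (τ a) (by omega) (h1.trans (congrArg idx (Fin.ext hab.symm)))
  exact hns t ht

end Moments

/-- A centered element of `adjoin G` is a linear combination of centered monomials in `G`. -/
lemma mem_span_centered_words {A : Type*} [Ring A] [Algebra ℂ A] (φ : A →ₗ[ℂ] ℂ) {G : Set A}
    {a : A} (ha : a ∈ Algebra.adjoin ℂ G) (h0 : φ a = 0) :
    a ∈ Submodule.span ℂ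
      {b | ∃ w : List A, (∀ y ∈ w, y ∈ G) ∧ b = w.prod - algebraMap ℂ A (φ w.prod)} := by
  let L : A →ₗ[ℂ] A := LinearMap.id - (Algebra.linearMap ℂ A).comp φ
  have hL : L a = a := by simp [L, h0]
  rw [← Subalgebra.mem_toSubmodule, Algebra.adjoin_eq_span] at ha
  rw [← hL]
  refine Submodule.span_mono ?_ (Submodule.map_span L _ ▸ Submodule.mem_map_of_mem ha)
  rintro _ ⟨m, hm, rfl⟩
  obtain ⟨w, hw, rfl⟩ := Submonoid.exists_list_of_mem_closure hm
  exact ⟨w, hw, rfl⟩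

lemma List.prod_ofFn_mem_span {R A : Type*} [CommSemiring R] [Semiring A] [Algebra R A] {k : ℕ}
    {S : Fin k → Set A} {a : Fin k → A} (h : ∀ t, a t ∈ Submodule.span R (S t)) :
    (List.ofFn a).prod ∈
      Submodule.span R {b | ∃ f : Fin k → A, (∀ t, f t ∈ S t) ∧ (List.ofFn f).prod = b} := by
  induction k with
  | zero => exact Submodule.subset_span ⟨a, fun t => t.elim0, rfl⟩
  | succ k ih =>
    rw [List.ofFn_succ, List.prod_cons]
    have := Submodule.mul_mem_mul (h 0) (ih fun t => h t.succ)
    rw [Submodule.span_mul_span] at this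
    refine Submodule.span_mono ?_ this
    rintro _ ⟨b, hb, _, ⟨f, hf, rfl⟩, rfl⟩
    exact ⟨Fin.cons b f, fun t => Fin.cases hb hf t, by simp [List.ofFn_succ]⟩

/-- Speicher: let `A₁ = adjoin G₁`, `A₂ = adjoin G₂` be unital
subalgebras of a non-commutative probability space `(A, φ)` with free cumulants `κ`.
If all mixed free cumulants of elements of the generating sets `G₁`, `G₂` vanish,
then `A₁` and `A₂` are freely independent: every alternating product of centered
elements of `A₁`, `A₂` is centered. -/
theorem stmt_8 {A : Type*} [Ring A] [Algebra ℂ A]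
    (φ : A →ₗ[ℂ] ℂ) (hunit : φ 1 = 1)
    (κ : ∀ k, (Fin k → A) → ℂ) (hκ : MomentCumulant φ κ)
    (G₁ G₂ : Set A)
    (hvan : ∀ (k : ℕ), k ≠ 0 → ∀ (idx : Fin k → Fin 2), (¬ ∀ s t, idx s = idx t) →
      ∀ a : Fin k → A, (∀ t, a t ∈ (if idx t = 0 then G₁ else G₂)) →
        κ k a = 0) :
    ∀ (k : ℕ), k ≠ 0 → ∀ (idx : Fin k → Fin 2) (a : Fin k → A),
      (∀ t, a t ∈ (if idx t = 0 then Algebra.adjoin ℂ G₁ else Algebra.adjoin ℂ G₂)) →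
      (∀ t, φ (a t) = 0) →
      (∀ (t : Fin k) (h : t.val + 1 < k), idx t ≠ idx ⟨t.val + 1, h⟩) →
      φ (List.ofFn a).prod = 0 := by
  intro k hk idx a ha h0 hidx
  have hspan := List.prod_ofFn_mem_span fun t =>
    mem_span_centered_words φ (G := if idx t = 0 then G₁ else G₂)
      (by have := ha t; split_ifs at this ⊢ <;> exact this) (h0 t)
  refine (Submodule.span_le (p := LinearMap.ker φ)).2 ?_ hspan
  rintro _ ⟨f, hf, rfl⟩
  choose w hw hfw using hf
  obtain rfl : f = _ := funext hfw
  exact hκ.centered_words hunit (fun i => if i = 0 then G₁ else G₂) hvan hk idx hidx w hw
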